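/- Let n ≥ 3, m := (n−2)/(n+2), c_n := 4(n−1)/(n−2), α := (n+2)/4, and T > 0. There is a constant C depending only on n with the following property. Let u, v : [0,T] × ℝ^n → ℝ be smooth positive functions satisfying ∂_t u = c_n Δ_x (u^m) and ∂_t v = c_n Δ_x (v^m) on [0,T] × ℝ^n, with u(t,x) = v(t,x) for all t whenever ‖x‖ is sufficiently large. Then for every R > 0 and every t ∈ [0,T]: ∫_{B_R(0)} |u(t,x) − v(t,x)| dx ≤ ( (∫_{B_{2R}(0)} |u(0,x) − v(0,x)| dx)^{1−m} + C · t · R^{((n−2)/2)(1−m)} )^{1/(1−m)}, where B_r(0) is the Euclidean ball of radius r about the origin. -/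

import Mathlib

open Filter MeasureTheory

/-- The Euclidean Laplacian on `ℝ^n`: the sum of the second partial derivatives. -/
noncomputable def lap {n : ℕ} (f : EuclideanSpace ℝ (Fin n) → ℝ)
    (x : EuclideanSpace ℝ (Fin n)) : ℝ :=
  ∑ i, fderiv ℝ (fun y => fderiv ℝ f y (EuclideanSpace.single i 1)) x (EuclideanSpace.single i 1)

theorem Real.abs_rpow_sub_rpow_le {a b m : ℝ} (ha : 0 ≤ a) (hb : 0 ≤ b) (hm0 : 0 ≤ m)
    (hm1 : m ≤ 1) : |a ^ m - b ^ m| ≤ |a - b| ^ m := by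
  wlog hab : b ≤ a generalizing a b
  · rw [abs_sub_comm, abs_sub_comm a b]
    exact this hb ha (le_of_not_ge hab)
  have h := Real.rpow_add_le_add_rpow hb (sub_nonneg.2 hab) hm0 hm1
  rw [add_sub_cancel] at h
  rw [abs_of_nonneg (sub_nonneg.2 hab),
    abs_of_nonneg (sub_nonneg.2 (Real.rpow_le_rpow hb hab hm0))]
  linarith

/-- Comparison principle for `Y' ≤ K Y ^ m`, with the derivative of `Y` from the left replaced by
the derivative of a function touching `Y` from below. -/
theorem le_rpow_of_touching_deriv_le {Y : ℝ → ℝ} {T K m : ℝ} (hm1 : m < 1)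
    (hK : 0 ≤ K) (hY : ContinuousOn Y (Set.Icc 0 T)) (hY0 : 0 ≤ Y 0)
    (hF : ∀ t ∈ Set.Ioc 0 T, ∃ (F : ℝ → ℝ) (D : ℝ), (∀ s ∈ Set.Icc 0 T, F s ≤ Y s) ∧ F t = Y t ∧
      HasDerivWithinAt F D (Set.Icc 0 T) t ∧ D ≤ K * Y t ^ m)
    {t : ℝ} (ht : t ∈ Set.Icc 0 T) :
    Y t ≤ (Y 0 ^ (1 - m) + (1 - m) * K * t) ^ (1 / (1 - m)) := by
  have hp : 0 < 1 - m := by linarith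
  set B : ℝ → ℝ → ℝ := fun δ s =>
    ((Y 0 + δ) ^ (1 - m) + ((1 - m) * K + δ) * s) ^ (1 / (1 - m)) with hB
  have hlt : ∀ δ > 0, ∀ s ∈ Set.Icc 0 T, Y s < B δ s := by
    intro δ hδ
    have hbase : ∀ s, 0 ≤ s → 0 < (Y 0 + δ) ^ (1 - m) + ((1 - m) * K + δ) * s := by
      intro s hs
      have := Real.rpow_pos_of_pos (show 0 < Y 0 + δ by linarith) (1 - m)
      positivity
    have hderiv : ∀ s, 0 ≤ s → HasDerivAt (B δ)
        ((K + δ / (1 - m)) * B δ s ^ m) s := by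
      intro s hs
      have h1 : HasDerivAt (fun s : ℝ => (Y 0 + δ) ^ (1 - m) + ((1 - m) * K + δ) * s)
          ((1 - m) * K + δ) s := by
        simpa using ((hasDerivAt_id s).const_mul ((1 - m) * K + δ)).const_add
          ((Y 0 + δ) ^ (1 - m))
      have h2 := h1.rpow_const (p := 1 / (1 - m)) (Or.inl (hbase s hs).ne')
      convert h2 using 1
      simp only [hB]
      rw [← Real.rpow_mul (hbase s hs).le]
      have : 1 / (1 - m) - 1 = 1 / (1 - m) * m := by field_simp; ring
      rw [this]
      field_simp
    have hcB : ContinuousOn (B δ) (Set.Icc 0 T) := fun s hs =>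
      (hderiv s hs.1).continuousAt.continuousWithinAt
    by_contra! hcon
    let S := {s ∈ Set.Icc 0 T | B δ s ≤ Y s}
    have hSc : IsCompact S :=
      isCompact_Icc.of_isClosed_subset
        (isClosed_Icc.isClosed_le hcB hY) (fun s hs => hs.1)
    obtain ⟨t1, ht1, hmin⟩ := hSc.exists_isLeast hcon
    have hB0 : B δ 0 = Y 0 + δ := by
      simp only [hB, mul_zero, add_zero]
      rw [← Real.rpow_mul (by linarith), mul_one_div_cancel hp.ne', Real.rpow_one]
    have ht1pos : 0 < t1 := by
      rcases ht1.1.1.eq_or_lt with h | h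
      · have := ht1.2
        rw [← h, hB0] at this
        linarith
      · exact h
    have hbefore : ∀ s ∈ Set.Ico 0 t1, Y s < B δ s := by
      intro s hs
      by_contra! h
      exact absurd (hmin ⟨⟨hs.1, hs.2.le.trans ht1.1.2⟩, h⟩) (not_le.2 hs.2)
    have hne : (nhdsWithin t1 (Set.Ico 0 t1)).NeBot := by
      rw [← mem_closure_iff_nhdsWithin_neBot, closure_Ico ht1pos.ne]
      exact ⟨ht1pos.le, le_rfl⟩
    have hsub : Set.Ico 0 t1 ⊆ Set.Icc 0 T := fun s hs => ⟨hs.1, hs.2.le.trans ht1.1.2⟩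
    have heq : Y t1 = B δ t1 := by
      refine le_antisymm ?_ ht1.2
      refine le_of_tendsto_of_tendsto ((hY t1 ht1.1).mono hsub) ((hcB t1 ht1.1).mono hsub) ?_
      filter_upwards [self_mem_nhdsWithin] with s hs using (hbefore s hs).le
    obtain ⟨F, D, hFY, hFt, hFD, hD⟩ := hF t1 ⟨ht1pos, ht1.1.2⟩
    have hG := (hFD.mono hsub).sub (hderiv t1 ht1pos.le).hasDerivWithinAt
    rw [hasDerivWithinAt_iff_tendsto_slope' (by simp)] at hG
    have hge : 0 ≤ D - (K + δ / (1 - m)) * B δ t1 ^ m := by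
      refine ge_of_tendsto hG ?_
      filter_upwards [self_mem_nhdsWithin] with s hs
      rw [slope_def_field]
      refine div_nonneg_of_nonpos ?_ (by linarith [hs.2])
      have := hFY s (hsub hs)
      have := hbefore s hs
      simp only [Pi.sub_apply]
      linarith
    have hBp : 0 < B δ t1 ^ m :=
      Real.rpow_pos_of_pos (Real.rpow_pos_of_pos (hbase t1 ht1pos.le) _) _
    rw [heq] at hD
    have : 0 < δ / (1 - m) * B δ t1 ^ m := by positivity
    linarith
  have hlim : Tendsto (fun δ => B δ t) (nhdsWithin 0 (Set.Ioi 0)) (nhds (B 0 t)) := by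
    have h1 : ContinuousAt (fun δ => (Y 0 + δ) ^ (1 - m)) 0 :=
      (continuousAt_const.add continuousAt_id).rpow_const (Or.inr hp.le)
    have h2 : ContinuousAt (fun δ => B δ t) 0 :=
      (h1.add ((continuousAt_const.add continuousAt_id).mul continuousAt_const)).rpow_const
        (Or.inr (by positivity))
    exact h2.tendsto.mono_left nhdsWithin_le_nhds
  have := ge_of_tendsto hlim (b := Y t) (by
    filter_upwards [self_mem_nhdsWithin] with δ hδ using (hlt δ hδ t ht).le)
  simpa [hB] using this

/-- Hölder's inequality for the concave power `m` on a set of finite measure. -/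
theorem setIntegral_rpow_le {α : Type*} [MeasurableSpace α] {μ : Measure α} {s : Set α}
    (hs : μ s ≠ ⊤) {m : ℝ} (hm0 : 0 < m) (hm1 : m < 1) {f : α → ℝ} (hf0 : 0 ≤ f)
    (hf : IntegrableOn f s μ) :
    ∫ x in s, f x ^ m ∂μ ≤ (∫ x in s, f x ∂μ) ^ m * μ.real s ^ (1 - m) := by
  have : IsFiniteMeasure (μ.restrict s) := ⟨by simpa using hs.lt_top⟩
  have hp : (1 / m).HolderConjugate (1 / (1 - m)) := by
    rw [Real.holderConjugate_iff]
    refine ⟨by rw [lt_div_iff₀ hm0]; linarith, by simp⟩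
  have h := integral_mul_le_Lp_mul_Lq_of_nonneg (μ := μ.restrict s) hp
    (f := fun x => f x ^ m) (g := fun _ => 1)
    (Eventually.of_forall fun x => Real.rpow_nonneg (hf0 x) _)
    (Eventually.of_forall fun x => zero_le_one) ?_ (memLp_const 1)
  · have h3 : ∀ x, (f x ^ m) ^ m⁻¹ = f x := fun x => by
      rw [← Real.rpow_mul (hf0 x), mul_inv_cancel₀ hm0.ne', Real.rpow_one]
    simpa [h3] using h
  · have h1 : MemLp f 1 (μ.restrict s) := memLp_one_iff_integrable.2 hf
    have h2 := h1.norm_rpow_div (ENNReal.ofReal m)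
    rw [ENNReal.toReal_ofReal hm0.le] at h2
    convert h2 using 1
    · ext x; simp [abs_of_nonneg (hf0 x)]
    · rw [ENNReal.ofReal_div_of_pos hm0]; simp

theorem Real.abs_sign_le_one (r : ℝ) : |Real.sign r| ≤ 1 := by
  rcases Real.sign_apply_eq r with h | h | h <;> simp [h]

theorem Real.sign_mul_self (r : ℝ) : Real.sign r * r = |r| := by
  rcases lt_trichotomy r 0 with h | h | h
  · rw [Real.sign_of_neg h, abs_of_neg h]; ring
  · simp [h]
  · rw [Real.sign_of_pos h, abs_of_pos h, one_mul]

theorem Real.measurable_sign : Measurable Real.sign := by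
  unfold Real.sign
  exact Measurable.ite measurableSet_Iio measurable_const
    (Measurable.ite measurableSet_Ioi measurable_const measurable_const)

section Kato

variable {E : Type*} [NormedAddCommGroup E] [NormedSpace ℝ E]

theorem ContDiff.fderiv_apply_const {f : E → ℝ} (hf : ContDiff ℝ (⊤ : ℕ∞) f) (e : E) :
    ContDiff ℝ (⊤ : ℕ∞) (fun y => fderiv ℝ f y e) :=
  (hf.fderiv_right (m := (⊤ : ℕ∞)) (by simp)).clm_apply contDiff_const

/-- Convexity of `s ↦ √(s ^ 2 + ε ^ 2)`, in terms of second directional derivatives. -/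
theorem div_sqrt_mul_fderiv_fderiv_le {g : E → ℝ} (hg : ContDiff ℝ (⊤ : ℕ∞) g) {ε : ℝ}
    (hε : 0 < ε) (e x : E) :
    g x / √(g x ^ 2 + ε ^ 2) * fderiv ℝ (fun y => fderiv ℝ g y e) x e ≤
      fderiv ℝ (fun y => fderiv ℝ (fun z => √(g z ^ 2 + ε ^ 2)) y e) x e := by
  have hpos : ∀ y, 0 < g y ^ 2 + ε ^ 2 := fun y => by positivity
  set H : E → ℝ := fun z => √(g z ^ 2 + ε ^ 2) with hH
  have hHpos : ∀ y, 0 < H y := fun y => Real.sqrt_pos.2 (hpos y)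
  have hHs : ContDiff ℝ (⊤ : ℕ∞) H :=
    ((hg.pow 2).add contDiff_const).sqrt fun y => (hpos y).ne'
  have hHd : Differentiable ℝ H := hHs.differentiable (by simp)
  have hgd : Differentiable ℝ g := hg.differentiable (by simp)
  have hH' : Differentiable ℝ (fun y => fderiv ℝ H y e) :=
    (hHs.fderiv_apply_const e).differentiable (by simp)
  have hg' : Differentiable ℝ (fun y => fderiv ℝ g y e) :=
    (hg.fderiv_apply_const e).differentiable (by simp)
  have hsq : (fun y => H y * H y) = fun y => g y * g y + ε ^ 2 := by
    ext y
    rw [hH, Real.mul_self_sqrt (hpos y).le]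
    ring
  have h1 : ∀ y, H y * fderiv ℝ H y e = g y * fderiv ℝ g y e := by
    intro y
    have h := congrArg (fun f => fderiv ℝ f y e) hsq
    simp only [fderiv_add_const] at h
    rw [fderiv_fun_mul (hHd y) (hHd y), fderiv_fun_mul (hgd y) (hgd y)] at h
    simp only [add_apply, smul_apply, smul_eq_mul] at h
    linarith
  have h2 := congrArg (fun f => fderiv ℝ f x e) (funext h1)
  beta_reduce at h2
  rw [fderiv_fun_mul (hHd x) (hH' x), fderiv_fun_mul (hgd x) (hg' x)] at h2
  simp only [add_apply, smul_apply, smul_eq_mul] at h2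
  have h3 : (fderiv ℝ H x e) ^ 2 ≤ (fderiv ℝ g x e) ^ 2 := by
    have h4 : H x ^ 2 * (fderiv ℝ H x e) ^ 2 = g x ^ 2 * (fderiv ℝ g x e) ^ 2 := by
      rw [← mul_pow, ← mul_pow, h1 x]
    have h5 : g x ^ 2 ≤ H x ^ 2 := by
      have := congrFun hsq x
      beta_reduce at this
      nlinarith [sq_nonneg ε]
    refine le_of_mul_le_mul_left ?_ (pow_pos (hHpos x) 2)
    rw [h4]
    exact mul_le_mul_of_nonneg_right h5 (sq_nonneg _)
  rw [div_mul_eq_mul_div, div_le_iff₀ (hHpos x)]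
  nlinarith

variable [FiniteDimensional ℝ E] [MeasurableSpace E] [BorelSpace E] {μ : Measure E}
  [μ.IsAddHaarMeasure]

theorem integral_mul_fderiv_fderiv_eq {ψ H : E → ℝ} (hψ : ContDiff ℝ (⊤ : ℕ∞) ψ)
    (hc : HasCompactSupport ψ) (hH : ContDiff ℝ (⊤ : ℕ∞) H) (e : E) :
    ∫ x, ψ x * fderiv ℝ (fun y => fderiv ℝ H y e) x e ∂μ =
      ∫ x, fderiv ℝ (fun y => fderiv ℝ ψ y e) x e * H x ∂μ := by
  have hH1 := hH.fderiv_apply_const e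
  have hH2 := hH1.fderiv_apply_const e
  have hψ1 := hψ.fderiv_apply_const e
  have hψ2 := hψ1.fderiv_apply_const e
  have hc1 := hc.fderiv_apply (𝕜 := ℝ) e
  have hc2 := hc1.fderiv_apply (𝕜 := ℝ) e
  have I : ∀ {f k : E → ℝ}, ContDiff ℝ (⊤ : ℕ∞) f → HasCompactSupport f →
      ContDiff ℝ (⊤ : ℕ∞) k → Integrable (fun x => f x * k x) μ := fun hf hfc hk =>
    (hf.continuous.mul hk.continuous).integrable_of_hasCompactSupport hfc.mul_right
  have D : ∀ {f : E → ℝ}, ContDiff ℝ (⊤ : ℕ∞) f → Differentiable ℝ f := fun hf =>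
    hf.differentiable (by simp)
  rw [integral_mul_fderiv_eq_neg_fderiv_mul_of_integrable (I hψ1 hc1 hH1) (I hψ hc hH2)
      (I hψ hc hH1) (fun x _ => D hψ x) (fun x _ => D hH1 x),
    integral_mul_fderiv_eq_neg_fderiv_mul_of_integrable (I hψ2 hc2 hH) (I hψ1 hc1 hH1)
      (I hψ1 hc1 hH) (fun x _ => D hψ1 x) (fun x _ => D hH x), neg_neg]

theorem tendsto_div_sqrt_sq_add_sq (s : ℝ) :
    Tendsto (fun ε : ℝ => s / √(s ^ 2 + ε ^ 2)) (nhdsWithin 0 (Set.Ioi 0))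
      (nhds (Real.sign s)) := by
  rcases eq_or_ne s 0 with rfl | hs
  · simp
  have hc : ContinuousAt (fun ε : ℝ => s / √(s ^ 2 + ε ^ 2)) 0 := by
    refine ContinuousAt.div continuousAt_const (by fun_prop) ?_
    simpa [Real.sqrt_sq_eq_abs] using hs
  have h : s / √(s ^ 2 + 0 ^ 2) = Real.sign s := by
    rw [zero_pow two_ne_zero, add_zero, Real.sqrt_sq_eq_abs, div_eq_iff (abs_pos.2 hs).ne',
      ← Real.sign_mul_self, ← mul_assoc]
    rcases Real.sign_apply_eq_of_ne_zero s hs with h | h <;> simp [h]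
  rw [← h]
  exact hc.tendsto.mono_left nhdsWithin_le_nhds

/-- Kato's inequality in one direction, tested against a nonnegative cutoff function. -/
theorem integral_mul_sign_mul_fderiv_fderiv_le {ψ g : E → ℝ} (hψ : ContDiff ℝ (⊤ : ℕ∞) ψ)
    (hc : HasCompactSupport ψ) (hψ0 : ∀ x, 0 ≤ ψ x) (hg : ContDiff ℝ (⊤ : ℕ∞) g) (e : E) :
    ∫ x, ψ x * (Real.sign (g x) * fderiv ℝ (fun y => fderiv ℝ g y e) x e) ∂μ ≤
      ∫ x, |fderiv ℝ (fun y => fderiv ℝ ψ y e) x e| * |g x| ∂μ := by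
  have hg2 := (hg.fderiv_apply_const e).fderiv_apply_const e
  have hψ2 := (hψ.fderiv_apply_const e).fderiv_apply_const e
  have hc2 := (hc.fderiv_apply (𝕜 := ℝ) e).fderiv_apply (𝕜 := ℝ) e
  set G : E → ℝ := fun x => fderiv ℝ (fun y => fderiv ℝ g y e) x e
  set P : E → ℝ := fun x => fderiv ℝ (fun y => fderiv ℝ ψ y e) x e
  have hPabs : HasCompactSupport fun x => |P x| := hc2.comp_left (g := fun s : ℝ => |s|) abs_zero
  have hPi : Integrable (fun x => |P x|) μ :=
    hψ2.continuous.abs.integrable_of_hasCompactSupport hPabs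
  have hPgi : Integrable (fun x => |P x| * |g x|) μ :=
    (hψ2.continuous.abs.mul hg.continuous.abs).integrable_of_hasCompactSupport hPabs.mul_right
  have hle1 : ∀ s ε : ℝ, |s / √(s ^ 2 + ε ^ 2)| ≤ 1 := by
    intro s ε
    rw [abs_div, abs_of_nonneg (Real.sqrt_nonneg _)]
    refine div_le_one_of_le₀ (Real.abs_le_sqrt ?_) (Real.sqrt_nonneg _)
    nlinarith [sq_nonneg ε]
  have hlim : Tendsto (fun ε : ℝ => ∫ x, ψ x * (g x / √(g x ^ 2 + ε ^ 2) * G x) ∂μ)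
      (nhdsWithin 0 (Set.Ioi 0)) (nhds (∫ x, ψ x * (Real.sign (g x) * G x) ∂μ)) := by
    refine tendsto_integral_filter_of_dominated_convergence (fun x => |ψ x * G x|) ?_ ?_ ?_ ?_
    · filter_upwards [self_mem_nhdsWithin] with ε hε
      have hε : 0 < ε := hε
      refine Continuous.aestronglyMeasurable ?_
      refine hψ.continuous.mul (Continuous.mul (hg.continuous.div ?_ fun x => ?_) hg2.continuous)
      · have := hg.continuous
        fun_prop
      · exact (Real.sqrt_pos.2 (by positivity)).ne'
    · refine Eventually.of_forall fun ε => Eventually.of_forall fun x => ?_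
      rw [Real.norm_eq_abs, abs_mul, abs_mul, abs_mul]
      exact mul_le_mul_of_nonneg_left
        (mul_le_of_le_one_left (abs_nonneg _) (hle1 _ _)) (abs_nonneg _)
    · exact ((hψ.continuous.mul hg2.continuous).integrable_of_hasCompactSupport
        hc.mul_right).abs
    · exact Eventually.of_forall fun x =>
        ((tendsto_div_sqrt_sq_add_sq (g x)).mul_const _).const_mul _
  have hlim2 : Tendsto (fun ε : ℝ => (∫ x, |P x| * |g x| ∂μ) + ε * ∫ x, |P x| ∂μ)
      (nhdsWithin 0 (Set.Ioi 0)) (nhds (∫ x, |P x| * |g x| ∂μ)) := by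
    have : Continuous fun ε : ℝ => (∫ x, |P x| * |g x| ∂μ) + ε * ∫ x, |P x| ∂μ := by fun_prop
    have h := (this.tendsto 0).mono_left (nhdsWithin_le_nhds (s := Set.Ioi (0 : ℝ)))
    simpa using h
  refine le_of_tendsto_of_tendsto hlim hlim2 ?_
  filter_upwards [self_mem_nhdsWithin] with ε hε
  have hε : 0 < ε := hε
  have hpos : ∀ y, 0 < g y ^ 2 + ε ^ 2 := fun y => by positivity
  have hHs : ContDiff ℝ (⊤ : ℕ∞) fun z => √(g z ^ 2 + ε ^ 2) :=
    ((hg.pow 2).add contDiff_const).sqrt fun y => (hpos y).ne'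
  have hH2 := (hHs.fderiv_apply_const e).fderiv_apply_const e
  calc ∫ x, ψ x * (g x / √(g x ^ 2 + ε ^ 2) * G x) ∂μ
      ≤ ∫ x, ψ x * fderiv ℝ (fun y => fderiv ℝ (fun z => √(g z ^ 2 + ε ^ 2)) y e) x e ∂μ := by
        refine integral_mono ?_ ?_ fun x =>
          mul_le_mul_of_nonneg_left (div_sqrt_mul_fderiv_fderiv_le hg hε e x) (hψ0 x)
        · refine Continuous.integrable_of_hasCompactSupport ?_ hc.mul_right
          exact hψ.continuous.mul ((hg.continuous.div hHs.continuous fun x =>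
            (Real.sqrt_pos.2 (hpos x)).ne').mul hg2.continuous)
        · exact (hψ.continuous.mul hH2.continuous).integrable_of_hasCompactSupport hc.mul_right
    _ = ∫ x, P x * √(g x ^ 2 + ε ^ 2) ∂μ := integral_mul_fderiv_fderiv_eq hψ hc hHs e
    _ ≤ ∫ x, (|P x| * |g x| + ε * |P x|) ∂μ := by
        refine integral_mono ?_ (hPgi.add (hPi.const_mul ε)) fun x => ?_
        · exact (hψ2.continuous.mul hHs.continuous).integrable_of_hasCompactSupport hc2.mul_right
        · have h1 : √(g x ^ 2 + ε ^ 2) ≤ |g x| + ε := by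
            refine Real.sqrt_le_iff.2 ⟨by positivity, ?_⟩
            nlinarith [sq_abs (g x), abs_nonneg (g x)]
          calc P x * √(g x ^ 2 + ε ^ 2) ≤ |P x| * √(g x ^ 2 + ε ^ 2) :=
                mul_le_mul_of_nonneg_right (le_abs_self _) (Real.sqrt_nonneg _)
            _ ≤ |P x| * (|g x| + ε) := mul_le_mul_of_nonneg_left h1 (abs_nonneg _)
            _ = |P x| * |g x| + ε * |P x| := by ring
    _ = _ := by rw [integral_add hPgi (hPi.const_mul ε), integral_const_mul]

end Kato

theorem abs_fderiv_fderiv_pow_le {E : Type*} [NormedAddCommGroup E] [NormedSpace ℝ E] {φ : E → ℝ}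
    (hφ : ContDiff ℝ (⊤ : ℕ∞) φ) (hφ0 : ∀ x, 0 ≤ φ x) (hφle : ∀ x, φ x ≤ 1) {A B m : ℝ}
    (hA : ∀ x, ‖fderiv ℝ φ x‖ ≤ A) (hB : ∀ x, ‖fderiv ℝ (fderiv ℝ φ) x‖ ≤ B) {j : ℕ}
    (hm0 : 0 ≤ m) (hj : 2 * m ≤ j * (1 - m)) {e : E} (he : ‖e‖ ≤ 1) (x : E) :
    |fderiv ℝ (fun y => fderiv ℝ (fun z => φ z ^ (j + 2)) y e) x e| ≤
      ((j + 2) * ((j + 1) * A ^ 2 + B)) * (φ x ^ (j + 2)) ^ m := by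
  have hφ1 : ContDiff ℝ (⊤ : ℕ∞) (fderiv ℝ φ) := hφ.fderiv_right (by simp)
  have hA0 : 0 ≤ A := (norm_nonneg _).trans (hA 0)
  have hB0 : 0 ≤ B := (norm_nonneg (fderiv ℝ (fderiv ℝ φ) 0)).trans (hB 0)
  have hφd : Differentiable ℝ φ := hφ.differentiable (by simp)
  have hP1 : ContDiff ℝ (⊤ : ℕ∞) (fun y => fderiv ℝ φ y e) := hφ.fderiv_apply_const e
  have hPd : Differentiable ℝ (fun y => fderiv ℝ φ y e) := hP1.differentiable (by simp)
  have h1 : (fun y => fderiv ℝ (fun z => φ z ^ (j + 2)) y e) =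
      fun y => ((j : ℝ) + 2) * (φ y ^ (j + 1) * fderiv ℝ φ y e) := by
    ext y
    rw [fderiv_fun_pow (j + 2) (hφd y)]
    simp
    ring
  have h2 : fderiv ℝ (fun y => fderiv ℝ φ y e) x e = fderiv ℝ (fderiv ℝ φ) x e e := by
    rw [fderiv_clm_apply (hφ1.differentiable (by simp) x) (by fun_prop)]
    simp
  have h3 : fderiv ℝ (fun y => fderiv ℝ (fun z => φ z ^ (j + 2)) y e) x e = ((j : ℝ) + 2) *
      (((j : ℝ) + 1) * (fderiv ℝ φ x e) ^ 2 + φ x * fderiv ℝ (fderiv ℝ φ) x e e) *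
        φ x ^ j := by
    rw [h1, fderiv_const_mul (DifferentiableAt.fun_mul (hφd.fun_pow (j + 1) x) (hPd x)),
      fderiv_fun_mul (hφd.fun_pow (j + 1) x) (hPd x), fderiv_fun_pow (j + 1) (hφd x)]
    simp [h2]
    ring
  have hAe : |fderiv ℝ φ x e| ≤ A :=
    ((fderiv ℝ φ x).le_opNorm e).trans
      ((mul_le_of_le_one_right (norm_nonneg _) he).trans (hA x))
  have hBe : |fderiv ℝ (fderiv ℝ φ) x e e| ≤ B := by
    refine ((fderiv ℝ (fderiv ℝ φ) x e).le_opNorm e).trans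
      ((mul_le_of_le_one_right (norm_nonneg _) he).trans ?_)
    exact ((fderiv ℝ (fderiv ℝ φ) x).le_opNorm e).trans
      ((mul_le_of_le_one_right (norm_nonneg _) he).trans (hB x))
  have hA2 : (fderiv ℝ φ x e) ^ 2 ≤ A ^ 2 := by
    rw [← sq_abs]; exact pow_le_pow_left₀ (abs_nonneg _) hAe 2
  have hpow : φ x ^ j ≤ (φ x ^ (j + 2)) ^ m := by
    rw [← Real.rpow_natCast (φ x) j, ← Real.rpow_natCast (φ x) (j + 2),
      ← Real.rpow_mul (hφ0 x)]
    refine Real.rpow_le_rpow_of_exponent_ge' (hφ0 x) (hφle x) (by positivity) ?_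
    push_cast
    linarith
  rw [h3, abs_mul, abs_mul, abs_of_nonneg (pow_nonneg (hφ0 x) j),
    abs_of_nonneg (by positivity : (0 : ℝ) ≤ (j : ℝ) + 2)]
  refine mul_le_mul (mul_le_mul_of_nonneg_left ?_ (by positivity)) hpow
    (pow_nonneg (hφ0 x) j) (by positivity)
  refine (abs_add_le _ _).trans (add_le_add ?_ ?_)
  · rw [abs_of_nonneg (by positivity)]
    gcongr
  · rw [abs_mul, abs_of_nonneg (hφ0 x)]
    exact (mul_le_of_le_one_left (abs_nonneg _) (hφle x)).trans hBe

theorem exists_norm_fderiv_le {E F : Type*} [NormedAddCommGroup E] [NormedSpace ℝ E]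
    [NormedAddCommGroup F] [NormedSpace ℝ F] {f : E → F} (hf : ContDiff ℝ (⊤ : ℕ∞) f)
    (hc : HasCompactSupport f) : ∃ A : ℝ, ∀ x, ‖fderiv ℝ f x‖ ≤ A :=
  (hc.fderiv (𝕜 := ℝ)).exists_bound_of_continuous (hf.continuous_fderiv (by simp))

theorem exists_unit_bump (E : Type*) [NormedAddCommGroup E] [InnerProductSpace ℝ E]
    [FiniteDimensional ℝ E] :
    ∃ φ : E → ℝ, ContDiff ℝ (⊤ : ℕ∞) φ ∧ HasCompactSupport φ ∧ (∀ x, 0 ≤ φ x) ∧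
      (∀ x, φ x ≤ 1) ∧ (∀ x, ‖x‖ ≤ 1 → φ x = 1) ∧ ∀ x, 2 ≤ ‖x‖ → φ x = 0 := by
  let φ : ContDiffBump (0 : E) := ⟨1, 2, one_pos, one_lt_two⟩
  exact ⟨φ, φ.contDiff, φ.hasCompactSupport, fun _ => φ.nonneg, fun _ => φ.le_one,
    fun x hx => φ.one_of_mem_closedBall (mem_closedBall_zero_iff.2 hx),
    fun x hx => φ.zero_of_le_dist (by rwa [dist_zero_right])⟩

theorem exists_cutoff {E : Type*} [NormedAddCommGroup E] [InnerProductSpace ℝ E]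
    [FiniteDimensional ℝ E] {m : ℝ} (hm0 : 0 ≤ m) (hm1 : m < 1) :
    ∃ C : ℝ, 0 ≤ C ∧ ∀ R : ℝ, 0 < R → ∃ ψ : E → ℝ, ContDiff ℝ (⊤ : ℕ∞) ψ ∧ HasCompactSupport ψ ∧
      (∀ x, 0 ≤ ψ x) ∧ (∀ x, ψ x ≤ 1) ∧ (∀ x ∈ Metric.ball 0 R, ψ x = 1) ∧
      (∀ x ∉ Metric.ball 0 (2 * R), ψ x = 0) ∧
      ∀ e : E, ‖e‖ ≤ 1 → ∀ x,
        |fderiv ℝ (fun y => fderiv ℝ ψ y e) x e| ≤ C * (R⁻¹ * R⁻¹) * ψ x ^ m := by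
  obtain ⟨j, hj⟩ := exists_nat_ge (2 * m / (1 - m))
  rw [div_le_iff₀ (by linarith)] at hj
  obtain ⟨φ, hφ, hφc, hφ0, hφle, hφone, hφz⟩ := exists_unit_bump E
  have hφ1 : ContDiff ℝ (⊤ : ℕ∞) (fderiv ℝ φ) := hφ.fderiv_right (by simp)
  obtain ⟨A, hA⟩ := exists_norm_fderiv_le hφ hφc
  obtain ⟨B, hB⟩ := exists_norm_fderiv_le hφ1 (hφc.fderiv (𝕜 := ℝ))
  have hA0 : 0 ≤ A := (norm_nonneg _).trans (hA 0)
  have hB0 : 0 ≤ B := (norm_nonneg (fderiv ℝ (fderiv ℝ φ) 0)).trans (hB 0)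
  let χ : E → ℝ := fun x => φ x ^ (j + 2)
  have hχ : ContDiff ℝ (⊤ : ℕ∞) χ := hφ.pow _
  have hbound : ∀ e : E, ‖e‖ ≤ 1 → ∀ x, |fderiv ℝ (fun y => fderiv ℝ χ y e) x e| ≤
      ((j + 2) * ((j + 1) * A ^ 2 + B)) * χ x ^ m := fun e he x =>
    abs_fderiv_fderiv_pow_le hφ hφ0 hφle hA hB hm0 hj he x
  refine ⟨(j + 2) * ((j + 1) * A ^ 2 + B), by positivity, fun R hR => ?_⟩
  have hnorm : ∀ x : E, ‖R⁻¹ • x‖ = ‖x‖ / R := fun x => by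
    rw [norm_smul, Real.norm_of_nonneg (by positivity), inv_mul_eq_div]
  have hzero : ∀ x ∉ Metric.ball (0 : E) (2 * R), χ (R⁻¹ • x) = 0 := by
    intro x hx
    rw [mem_ball_zero_iff, not_lt] at hx
    have : φ (R⁻¹ • x) = 0 := hφz _ (by
      rw [hnorm, le_div_iff₀ hR]; exact hx)
    simp [χ, this]
  refine ⟨fun x => χ (R⁻¹ • x), hχ.comp (contDiff_const_smul _), ?_,
    fun x => pow_nonneg (hφ0 _) _, fun x => pow_le_one₀ (hφ0 _) (hφle _), ?_, hzero, ?_⟩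
  · exact HasCompactSupport.intro (isCompact_closedBall 0 (2 * R)) fun x hx =>
      hzero x fun h => hx (Metric.ball_subset_closedBall h)
  · intro x hx
    rw [mem_ball_zero_iff] at hx
    have : φ (R⁻¹ • x) = 1 := hφone _ (by
      rw [hnorm, div_le_iff₀ hR]
      linarith)
    simp [χ, this]
  · intro e he x
    have h1 : (fun y => fderiv ℝ (fun x => χ (R⁻¹ • x)) y e) =
        fun y => R⁻¹ * fderiv ℝ χ (R⁻¹ • y) e := by
      ext y
      rw [fderiv_comp_smul]
      simp
    have hd : Differentiable ℝ (fun z => fderiv ℝ χ z e) :=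
      (hχ.fderiv_apply_const e).differentiable (by simp)
    have h2 : fderiv ℝ (fun y => fderiv ℝ χ (R⁻¹ • y) e) x =
        R⁻¹ • fderiv ℝ (fun z => fderiv ℝ χ z e) (R⁻¹ • x) :=
      fderiv_comp_smul (f := fun z => fderiv ℝ χ z e) R⁻¹
    have hd2 : DifferentiableAt ℝ (fun y => fderiv ℝ χ (R⁻¹ • y) e) x :=
      (hd (R⁻¹ • x)).comp x (differentiableAt_id.const_smul R⁻¹)
    rw [h1, fderiv_const_mul hd2, h2]
    simp only [smul_apply, smul_eq_mul]
    rw [← mul_assoc, abs_mul, abs_of_nonneg (by positivity), mul_comm, mul_right_comm]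
    exact mul_le_mul_of_nonneg_right (hbound e he _) (by positivity)

theorem hasDerivWithinAt_integral_of_lipschitz {α : Type*} [MeasurableSpace α] {μ : Measure α}
    {S : Set ℝ} {k : α → ℝ} {w : ℝ → α → ℝ} {w' : α → ℝ} {L t : ℝ} (ht : t ∈ S)
    (hk : Integrable k μ) (hkw : ∀ s ∈ S, Integrable (fun x => k x * w s x) μ)
    (hL : ∀ s ∈ S, ∀ x, k x ≠ 0 → |w s x - w t x| ≤ L * |s - t|)
    (hw : ∀ x, HasDerivWithinAt (fun s => w s x) (w' x) S t) :
    HasDerivWithinAt (fun s => ∫ x, k x * w s x ∂μ) (∫ x, k x * w' x ∂μ) S t := by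
  rw [hasDerivWithinAt_iff_tendsto_slope]
  have hslope : ∀ s ∈ S, slope (fun s => ∫ x, k x * w s x ∂μ) t s =
      ∫ x, k x * slope (fun s => w s x) t s ∂μ := by
    intro s hs
    rw [slope_def_field, ← integral_sub (hkw s hs) (hkw t ht), ← integral_div]
    refine integral_congr_ae (Eventually.of_forall fun x => ?_)
    simp only [slope_def_field]
    ring
  have hlim : Tendsto (fun s => ∫ x, k x * slope (fun s => w s x) t s ∂μ)
      (nhdsWithin t (S \ {t})) (nhds (∫ x, k x * w' x ∂μ)) := by
    refine tendsto_integral_filter_of_dominated_convergence (fun x => |k x| * L) ?_ ?_ ?_ ?_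
    · filter_upwards [self_mem_nhdsWithin] with s hs
      have := ((hkw s hs.1).sub (hkw t ht)).div_const (s - t)
      refine this.aestronglyMeasurable.congr (Eventually.of_forall fun x => ?_)
      simp only [slope_def_field, Pi.sub_apply]
      ring
    · filter_upwards [self_mem_nhdsWithin] with s hs
      refine Eventually.of_forall fun x => ?_
      rw [norm_mul, Real.norm_eq_abs]
      rcases eq_or_ne (k x) 0 with h | h
      · simp [h]
      · refine mul_le_mul_of_nonneg_left ?_ (abs_nonneg _)
        rw [slope_def_field, Real.norm_eq_abs, abs_div, div_le_iff₀]
        · exact hL s hs.1 x h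
        · exact abs_pos.2 (sub_ne_zero.2 hs.2)
    · exact hk.abs.mul_const L
    · exact Eventually.of_forall fun x =>
        (hasDerivWithinAt_iff_tendsto_slope.1 (hw x)).const_mul _
  refine hlim.congr' ?_
  filter_upwards [self_mem_nhdsWithin] with s hs using (hslope s hs.1).symm

theorem sign_rpow_sub_rpow {a b m : ℝ} (ha : 0 ≤ a) (hb : 0 ≤ b) (hm : 0 < m) :
    Real.sign (a ^ m - b ^ m) = Real.sign (a - b) := by
  rcases lt_trichotomy a b with h | h | h
  · rw [Real.sign_of_neg (sub_neg.2 h),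
      Real.sign_of_neg (sub_neg.2 (Real.rpow_lt_rpow ha h hm))]
  · simp [h]
  · rw [Real.sign_of_pos (sub_pos.2 h),
      Real.sign_of_pos (sub_pos.2 (Real.rpow_lt_rpow hb h hm))]

theorem integral_mul_sign_mul_lap_rpow_sub_le {n : ℕ} {a b ψ : EuclideanSpace ℝ (Fin n) → ℝ}
    {m r C : ℝ} (hm0 : 0 < m) (hm1 : m < 1) (ha : ContDiff ℝ (⊤ : ℕ∞) a)
    (hb : ContDiff ℝ (⊤ : ℕ∞) b) (ha0 : ∀ x, 0 < a x) (hb0 : ∀ x, 0 < b x)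
    (hψ : ContDiff ℝ (⊤ : ℕ∞) ψ) (hc : HasCompactSupport ψ) (hψ0 : ∀ x, 0 ≤ ψ x)
    (hψr : ∀ x ∉ Metric.ball 0 r, ψ x = 0) (hC : 0 ≤ C)
    (hψC : ∀ e : EuclideanSpace ℝ (Fin n), ‖e‖ ≤ 1 → ∀ x,
      |fderiv ℝ (fun y => fderiv ℝ ψ y e) x e| ≤ C * ψ x ^ m) :
    ∫ x, ψ x * (Real.sign (a x - b x) *
        (lap (fun y => a y ^ m) x - lap (fun y => b y ^ m) x)) ≤
      n * C * volume.real (Metric.ball (0 : EuclideanSpace ℝ (Fin n)) r) ^ (1 - m) *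
        (∫ x, ψ x * |a x - b x|) ^ m := by
  have ham : ContDiff ℝ (⊤ : ℕ∞) fun y => a y ^ m := ha.rpow_const_of_ne fun x => (ha0 x).ne'
  have hbm : ContDiff ℝ (⊤ : ℕ∞) fun y => b y ^ m := hb.rpow_const_of_ne fun x => (hb0 x).ne'
  set g : EuclideanSpace ℝ (Fin n) → ℝ := fun y => a y ^ m - b y ^ m with hgdef
  have hg : ContDiff ℝ (⊤ : ℕ∞) g := ham.sub hbm
  have D : ∀ {f : EuclideanSpace ℝ (Fin n) → ℝ}, ContDiff ℝ (⊤ : ℕ∞) f → Differentiable ℝ f :=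
    fun hf => hf.differentiable (by simp)
  have hdd : ∀ x e, fderiv ℝ (fun y => fderiv ℝ g y e) x e =
      fderiv ℝ (fun y => fderiv ℝ (fun y => a y ^ m) y e) x e -
        fderiv ℝ (fun y => fderiv ℝ (fun y => b y ^ m) y e) x e := by
    intro x e
    have h1 : (fun y => fderiv ℝ g y e) = fun y =>
        fderiv ℝ (fun y => a y ^ m) y e - fderiv ℝ (fun y => b y ^ m) y e := by
      ext y
      rw [hgdef, fderiv_fun_sub (D ham y) (D hbm y)]
      rfl
    rw [h1, fderiv_fun_sub (D (ham.fderiv_apply_const e) x) (D (hbm.fderiv_apply_const e) x)]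
    rfl
  have hsum : ∀ x, ψ x * (Real.sign (a x - b x) *
      (lap (fun y => a y ^ m) x - lap (fun y => b y ^ m) x)) =
      ∑ i, ψ x * (Real.sign (g x) * fderiv ℝ (fun y => fderiv ℝ g y
        (EuclideanSpace.single i 1)) x (EuclideanSpace.single i 1)) := by
    intro x
    rw [lap, lap, ← Finset.sum_sub_distrib, ← Finset.mul_sum, ← Finset.mul_sum,
      ← sign_rpow_sub_rpow (ha0 x).le (hb0 x).le hm0]
    exact congrArg _ (congrArg _ (Finset.sum_congr rfl fun i _ => (hdd x _).symm))
  have hint : ∀ e, Integrable fun x => ψ x * (Real.sign (g x) *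
      fderiv ℝ (fun y => fderiv ℝ g y e) x e) := by
    intro e
    have hi : Integrable fun x => ψ x * fderiv ℝ (fun y => fderiv ℝ g y e) x e :=
      (hψ.continuous.mul ((hg.fderiv_apply_const e).fderiv_apply_const
        e).continuous).integrable_of_hasCompactSupport hc.mul_right
    refine (hi.bdd_mul (c := 1)
      (Real.measurable_sign.comp hg.continuous.measurable).aestronglyMeasurable
      (Eventually.of_forall fun x => Real.abs_sign_le_one _)).congr
      (Eventually.of_forall fun x => ?_)
    simp only [Function.comp]
    ring
  have hwc : Continuous fun x => ψ x * |a x - b x| :=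
    hψ.continuous.mul (ha.continuous.sub hb.continuous).abs
  have hwi : Integrable fun x => ψ x * |a x - b x| :=
    hwc.integrable_of_hasCompactSupport hc.mul_right
  have hw0 : ∀ x, 0 ≤ ψ x * |a x - b x| := fun x => mul_nonneg (hψ0 x) (abs_nonneg _)
  have hterm : ∀ e : EuclideanSpace ℝ (Fin n), ‖e‖ ≤ 1 →
      ∫ x, ψ x * (Real.sign (g x) * fderiv ℝ (fun y => fderiv ℝ g y e) x e) ≤
      C * (volume.real (Metric.ball (0 : EuclideanSpace ℝ (Fin n)) r) ^ (1 - m) *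
        (∫ x, ψ x * |a x - b x|) ^ m) := by
    intro e he
    have hpowc : Continuous fun x => (ψ x * |a x - b x|) ^ m :=
      hwc.rpow_const fun x => Or.inr hm0.le
    have hpows : HasCompactSupport fun x => (ψ x * |a x - b x|) ^ m :=
      (hc.mul_right (f' := fun x => |a x - b x|)).comp_left (g := fun s : ℝ => s ^ m)
        (Real.zero_rpow hm0.ne')
    refine (integral_mul_sign_mul_fderiv_fderiv_le hψ hc hψ0 hg e).trans ?_
    calc ∫ x, |fderiv ℝ (fun y => fderiv ℝ ψ y e) x e| * |g x|
        ≤ ∫ x, C * (ψ x * |a x - b x|) ^ m := by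
          refine integral_mono_of_nonneg (Eventually.of_forall fun x => by positivity)
            ((hpowc.integrable_of_hasCompactSupport hpows).const_mul C)
            (Eventually.of_forall fun x => ?_)
          simp only
          rw [Real.mul_rpow (hψ0 x) (abs_nonneg _), ← mul_assoc]
          exact mul_le_mul (hψC e he x)
            (Real.abs_rpow_sub_rpow_le (ha0 x).le (hb0 x).le hm0.le hm1.le) (abs_nonneg _)
            (mul_nonneg hC (Real.rpow_nonneg (hψ0 x) _))
      _ = C * ∫ x in Metric.ball 0 r, (ψ x * |a x - b x|) ^ m := by
          rw [integral_const_mul, setIntegral_eq_integral_of_forall_compl_eq_zero]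
          intro x hx
          rw [hψr x hx, zero_mul, Real.zero_rpow hm0.ne']
      _ ≤ _ := by
          refine mul_le_mul_of_nonneg_left ?_ hC
          refine (setIntegral_rpow_le measure_ball_lt_top.ne hm0 hm1 hw0
            hwi.integrableOn).trans_eq ?_
          rw [setIntegral_eq_integral_of_forall_compl_eq_zero, mul_comm]
          intro x hx
          rw [hψr x hx, zero_mul]
  simp only [hsum]
  rw [integral_finsetSum _ fun i _ => hint _]
  refine (Finset.sum_le_sum fun i _ => hterm _ (by simp)).trans_eq ?_
  simp
  ring

theorem exists_lipschitz_in_time {E : Type*} [NormedAddCommGroup E] [NormedSpace ℝ E]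
    [FiniteDimensional ℝ E] {T r : ℝ} {u : ℝ × E → ℝ}
    (hu : ContDiffOn ℝ (⊤ : ℕ∞) u (Set.Icc 0 T ×ˢ Set.univ)) :
    ∃ L : ℝ, ∀ s ∈ Set.Icc 0 T, ∀ t ∈ Set.Icc 0 T, ∀ x ∈ Metric.closedBall (0 : E) r,
      |u (s, x) - u (t, x)| ≤ L * |s - t| := by
  obtain ⟨L, hL⟩ := (hu.mono (Set.prod_mono_right
    (Set.subset_univ (Metric.closedBall (0 : E) r)))).exists_lipschitzOnWith (by simp)
    ((convex_Icc 0 T).prod (convex_closedBall 0 r)) (isCompact_Icc.prod (isCompact_closedBall 0 r))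
  refine ⟨L, fun s hs t ht x hx => ?_⟩
  have h := hL.dist_le_mul (s, x) ⟨hs, hx⟩ (t, x) ⟨ht, hx⟩
  rwa [dist_prod_same_right, Real.dist_eq, Real.dist_eq] at h

theorem contDiff_slice {E : Type*} [NormedAddCommGroup E] [NormedSpace ℝ E] {S : Set ℝ}
    {u : ℝ × E → ℝ} (hu : ContDiffOn ℝ (⊤ : ℕ∞) u (S ×ˢ Set.univ)) {t : ℝ} (ht : t ∈ S) :
    ContDiff ℝ (⊤ : ℕ∞) fun x => u (t, x) := by
  rw [← contDiffOn_univ]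
  exact hu.comp (contDiff_prodMk_right t).contDiffOn fun x _ => ⟨ht, Set.mem_univ x⟩

/-- Weighted stability: the cutoff integral of `|u - v|` satisfies the integrated form of
`Y' ≤ K Y ^ m`. -/
theorem integral_cutoff_mul_abs_sub_le {n : ℕ} {m cn T r C : ℝ} (hm0 : 0 < m) (hm1 : m < 1)
    (hcn : 0 ≤ cn) {u v : ℝ × EuclideanSpace ℝ (Fin n) → ℝ}
    (hu : ContDiffOn ℝ (⊤ : ℕ∞) u (Set.Icc 0 T ×ˢ Set.univ))
    (hv : ContDiffOn ℝ (⊤ : ℕ∞) v (Set.Icc 0 T ×ˢ Set.univ))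
    (hu0 : ∀ t ∈ Set.Icc (0 : ℝ) T, ∀ x, 0 < u (t, x))
    (hv0 : ∀ t ∈ Set.Icc (0 : ℝ) T, ∀ x, 0 < v (t, x))
    (hut : ∀ t ∈ Set.Icc (0 : ℝ) T, ∀ x,
      HasDerivWithinAt (fun s => u (s, x)) (cn * lap (fun y => u (t, y) ^ m) x) (Set.Icc 0 T) t)
    (hvt : ∀ t ∈ Set.Icc (0 : ℝ) T, ∀ x,
      HasDerivWithinAt (fun s => v (s, x)) (cn * lap (fun y => v (t, y) ^ m) x) (Set.Icc 0 T) t)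
    {ψ : EuclideanSpace ℝ (Fin n) → ℝ}
    (hψ : ContDiff ℝ (⊤ : ℕ∞) ψ) (hc : HasCompactSupport ψ) (hψ0 : ∀ x, 0 ≤ ψ x)
    (hψr : ∀ x ∉ Metric.ball 0 r, ψ x = 0) (hC : 0 ≤ C)
    (hψC : ∀ e : EuclideanSpace ℝ (Fin n), ‖e‖ ≤ 1 → ∀ x,
      |fderiv ℝ (fun y => fderiv ℝ ψ y e) x e| ≤ C * ψ x ^ m) {t : ℝ} (ht : t ∈ Set.Icc 0 T) :
    ∫ x, ψ x * |u (t, x) - v (t, x)| ≤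
      ((∫ x, ψ x * |u (0, x) - v (0, x)|) ^ (1 - m) + (1 - m) * (cn *
        (n * C * volume.real (Metric.ball (0 : EuclideanSpace ℝ (Fin n)) r) ^ (1 - m))) * t) ^
          (1 / (1 - m)) := by
  have hcont : ContinuousOn (fun p => u p - v p) (Set.Icc 0 T ×ˢ Set.univ) :=
    hu.continuousOn.sub hv.continuousOn
  have hslice : ∀ s ∈ Set.Icc (0 : ℝ) T, Continuous fun x => u (s, x) - v (s, x) := fun s hs =>
    (contDiff_slice hu hs).continuous.sub (contDiff_slice hv hs).continuous
  have hψb : ∀ x, ψ x ≠ 0 → x ∈ Metric.closedBall 0 r := fun x hx =>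
    Metric.ball_subset_closedBall (by_contra fun h => hx (hψr x h))
  refine le_rpow_of_touching_deriv_le (Y := fun s => ∫ x, ψ x * |u (s, x) - v (s, x)|) (T := T)
    hm1 (by positivity) ?_ (integral_nonneg fun x => mul_nonneg (hψ0 x) (abs_nonneg _)) ?_ ht
  · refine continuousOn_integral_of_compact_support (isCompact_closedBall 0 r) ?_ ?_
    · exact (hψ.continuous.comp continuous_snd).continuousOn.mul hcont.abs
    · intro s x _ hx
      rw [not_imp_comm.1 (hψb x) hx, zero_mul]
  intro t ht'
  have ht : t ∈ Set.Icc 0 T := ⟨ht'.1.le, ht'.2⟩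
  set σ : EuclideanSpace ℝ (Fin n) → ℝ := fun x => Real.sign (u (t, x) - v (t, x)) with hσ
  have hσi : ∀ {f : EuclideanSpace ℝ (Fin n) → ℝ}, Integrable f →
      Integrable fun x => σ x * f x := fun hf =>
    hf.bdd_mul (c := 1)
      (Real.measurable_sign.comp (hslice t ht).measurable).aestronglyMeasurable
      (Eventually.of_forall fun x => Real.abs_sign_le_one _)
  have hψw : ∀ s ∈ Set.Icc (0 : ℝ) T, Integrable fun x => ψ x * (u (s, x) - v (s, x)) :=
    fun s hs => (hψ.continuous.mul (hslice s hs)).integrable_of_hasCompactSupport hc.mul_right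
  have hψa : ∀ s ∈ Set.Icc (0 : ℝ) T, Integrable fun x => ψ x * |u (s, x) - v (s, x)| :=
    fun s hs => (hψ.continuous.mul (hslice s hs).abs).integrable_of_hasCompactSupport hc.mul_right
  have hkw : ∀ s ∈ Set.Icc (0 : ℝ) T,
      Integrable fun x => (σ x * ψ x) * (u (s, x) - v (s, x)) := fun s hs => by
    simpa only [mul_assoc] using hσi (hψw s hs)
  obtain ⟨L, hL⟩ := exists_lipschitz_in_time (r := r) hu
  obtain ⟨L', hL'⟩ := exists_lipschitz_in_time (r := r) hv
  refine ⟨fun s => ∫ x, (σ x * ψ x) * (u (s, x) - v (s, x)),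
    ∫ x, (σ x * ψ x) * (cn * lap (fun y => u (t, y) ^ m) x - cn * lap (fun y => v (t, y) ^ m) x),
    ?_, ?_, ?_, ?_⟩
  · refine fun s hs => integral_mono (hkw s hs) (hψa s hs) fun x => ?_
    simp only
    rw [mul_comm (σ x), mul_assoc]
    refine mul_le_mul_of_nonneg_left ((le_abs_self _).trans ?_) (hψ0 x)
    rw [abs_mul]
    exact mul_le_of_le_one_left (abs_nonneg _) (Real.abs_sign_le_one _)
  · refine integral_congr_ae (Eventually.of_forall fun x => ?_)
    simp only
    rw [mul_comm (σ x), mul_assoc, hσ, Real.sign_mul_self]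
  · refine hasDerivWithinAt_integral_of_lipschitz
      (w := fun s x => u (s, x) - v (s, x)) (L := L + L') ht
      (hσi (hψ.continuous.integrable_of_hasCompactSupport hc)) hkw ?_
      fun x => (hut t ht x).sub (hvt t ht x)
    intro s hs x hx
    have hx' := hψb x (right_ne_zero_of_mul hx)
    have h1 := hL s hs t ht x hx'
    have h2 := hL' s hs t ht x hx'
    calc |u (s, x) - v (s, x) - (u (t, x) - v (t, x))|
        = |(u (s, x) - u (t, x)) - (v (s, x) - v (t, x))| := by ring_nf
      _ ≤ |u (s, x) - u (t, x)| + |v (s, x) - v (t, x)| := abs_sub _ _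
      _ ≤ (L + L') * |s - t| := by linarith
  · have h := integral_mul_sign_mul_lap_rpow_sub_le hm0 hm1 (contDiff_slice hu ht)
      (contDiff_slice hv ht) (hu0 t ht) (hv0 t ht) hψ hc hψ0 hψr hC hψC
    have heq : ∀ x, (σ x * ψ x) *
        (cn * lap (fun y => u (t, y) ^ m) x - cn * lap (fun y => v (t, y) ^ m) x) =
        cn * (ψ x * (Real.sign (u (t, x) - v (t, x)) *
          (lap (fun y => u (t, y) ^ m) x - lap (fun y => v (t, y) ^ m) x))) := fun x => by
      simp only [hσ]
      ring
    simp only [heq]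
    rw [integral_const_mul]
    exact (mul_le_mul_of_nonneg_left h hcn).trans_eq (by ring)

/-- Quantitative local-in-time `L¹`-stability bound for the Yamabe flow in porous-medium
form `∂ₜ u = c_n Δ(u^m)` on flat `ℝ^n`. -/
theorem yamabe_flow_quantitative_L1_stability (n : ℕ) (hn : 3 ≤ n) (m cn : ℝ)
    (hm : m = ((n : ℝ) - 2) / ((n : ℝ) + 2))
    (hcn : cn = 4 * ((n : ℝ) - 1) / ((n : ℝ) - 2)) :
    ∃ C : ℝ, 0 < C ∧
      ∀ T : ℝ, 0 < T →
      ∀ u v : ℝ × EuclideanSpace ℝ (Fin n) → ℝ,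
        ContDiffOn ℝ (⊤ : ℕ∞) u (Set.Icc 0 T ×ˢ Set.univ) →
        ContDiffOn ℝ (⊤ : ℕ∞) v (Set.Icc 0 T ×ˢ Set.univ) →
        (∀ t ∈ Set.Icc (0 : ℝ) T, ∀ x, 0 < u (t, x)) →
        (∀ t ∈ Set.Icc (0 : ℝ) T, ∀ x, 0 < v (t, x)) →
        (∀ t ∈ Set.Icc (0 : ℝ) T, ∀ x,
          HasDerivWithinAt (fun s => u (s, x)) (cn * lap (fun y => u (t, y) ^ m) x)
            (Set.Icc 0 T) t) →
        (∀ t ∈ Set.Icc (0 : ℝ) T, ∀ x,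
          HasDerivWithinAt (fun s => v (s, x)) (cn * lap (fun y => v (t, y) ^ m) x)
            (Set.Icc 0 T) t) →
        (∃ R₀ : ℝ, ∀ t ∈ Set.Icc (0 : ℝ) T, ∀ x : EuclideanSpace ℝ (Fin n),
          R₀ ≤ ‖x‖ → u (t, x) = v (t, x)) →
        ∀ R : ℝ, 0 < R → ∀ t ∈ Set.Icc (0 : ℝ) T,
          ∫ x in Metric.ball (0 : EuclideanSpace ℝ (Fin n)) R, |u (t, x) - v (t, x)| ≤
            ((∫ x in Metric.ball (0 : EuclideanSpace ℝ (Fin n)) (2 * R),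
                |u (0, x) - v (0, x)|) ^ (1 - m) +
              C * t * R ^ ((((n : ℝ) - 2) / 2) * (1 - m))) ^ (1 / (1 - m)) := by
  have hn' : (3 : ℝ) ≤ n := by exact_mod_cast hn
  have hm0 : 0 < m := by rw [hm]; exact div_pos (by linarith) (by linarith)
  have hm1 : m < 1 := by rw [hm, div_lt_one (by linarith)]; linarith
  have hcn0 : 0 < cn := by rw [hcn]; exact div_pos (by linarith) (by linarith)
  have hp : 0 < 1 - m := by linarith
  obtain ⟨C₀, hC₀, hcut⟩ := exists_cutoff (E := EuclideanSpace ℝ (Fin n)) hm0.le hm1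
  set V : ℝ := volume.real (Metric.ball (0 : EuclideanSpace ℝ (Fin n)) 1)
  have hV : 0 ≤ V := measureReal_nonneg
  refine ⟨(1 - m) * (cn * (n * C₀ * (2 ^ n * V) ^ (1 - m))) + 1, by positivity, ?_⟩
  intro T hT u v hu hv hu0 hv0 hut hvt _ R hR t ht
  obtain ⟨ψ, hψ, hc, hψ0, hψ1, hψeq, hψz, hψC⟩ := hcut R hR
  have h0 : (0 : ℝ) ∈ Set.Icc 0 T := ⟨le_rfl, hT.le⟩
  have hslice : ∀ s ∈ Set.Icc (0 : ℝ) T, Continuous fun x => |u (s, x) - v (s, x)| := fun s hs =>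
    ((contDiff_slice hu hs).continuous.sub (contDiff_slice hv hs).continuous).abs
  have hψi : ∀ s ∈ Set.Icc (0 : ℝ) T, Integrable fun x => ψ x * |u (s, x) - v (s, x)| :=
    fun s hs => (hψ.continuous.mul (hslice s hs)).integrable_of_hasCompactSupport hc.mul_right
  have hψn : ∀ s x, 0 ≤ ψ x * |u (s, x) - v (s, x)| := fun s x =>
    mul_nonneg (hψ0 x) (abs_nonneg _)
  have hleft : ∫ x in Metric.ball 0 R, |u (t, x) - v (t, x)| ≤
      ∫ x, ψ x * |u (t, x) - v (t, x)| := by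
    refine le_trans (le_of_eq ?_) (setIntegral_le_integral (s := Metric.ball 0 R) (hψi t ht)
      (Eventually.of_forall (hψn t)))
    refine setIntegral_congr_fun measurableSet_ball fun x hx => ?_
    simp only [hψeq x hx, one_mul]
  have hright : ∫ x, ψ x * |u (0, x) - v (0, x)| ≤
      ∫ x in Metric.ball 0 (2 * R), |u (0, x) - v (0, x)| := by
    rw [← setIntegral_eq_integral_of_forall_compl_eq_zero (s := Metric.ball 0 (2 * R))
      fun x hx => by rw [hψz x hx, zero_mul]]
    refine setIntegral_mono (hψi 0 h0).integrableOn ?_ fun x =>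
      mul_le_of_le_one_left (abs_nonneg _) (hψ1 x)
    exact ((hslice 0 h0).continuousOn.integrableOn_compact
      (isCompact_closedBall 0 (2 * R))).mono_set Metric.ball_subset_closedBall
  have hvol : volume.real (Metric.ball (0 : EuclideanSpace ℝ (Fin n)) (2 * R)) =
      (2 ^ n * V) * R ^ n := by
    rw [Measure.real, Measure.addHaar_ball_of_pos _ _ (by positivity), ENNReal.toReal_mul,
      ENNReal.toReal_ofReal (by positivity), finrank_euclideanSpace_fin, mul_pow]
    simp only [V, Measure.real]
    ring
  have hexp : R⁻¹ * R⁻¹ * (R ^ n) ^ (1 - m) = R ^ ((((n : ℝ) - 2) / 2) * (1 - m)) := by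
    rw [← Real.rpow_neg_one, ← Real.rpow_natCast R n, ← Real.rpow_mul hR.le, ← Real.rpow_add hR,
      ← Real.rpow_add hR]
    congr 1
    rw [hm]
    field_simp
    ring
  refine hleft.trans ((integral_cutoff_mul_abs_sub_le hm0 hm1 hcn0.le hu hv hu0 hv0 hut hvt hψ hc
    hψ0 hψz (by positivity) hψC ht).trans ?_)
  have hI : 0 ≤ ∫ x, ψ x * |u (0, x) - v (0, x)| := integral_nonneg (hψn 0)
  have ht0 : 0 ≤ t := ht.1
  refine Real.rpow_le_rpow (by positivity) (add_le_add ?_ ?_) (by positivity)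
  · exact Real.rpow_le_rpow hI hright hp.le
  · rw [hvol, Real.mul_rpow (by positivity) (by positivity), ← hexp]
    have h : 0 ≤ t * (R⁻¹ * R⁻¹ * (R ^ n) ^ (1 - m)) := by positivity
    linarith
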